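/- Let c, d > 0 with c·d ≤ 1, let 0 < a ≤ b, and define g(x) = x·F(c,d;c+d;x) for x ∈ (0,1). Then for every s ≥ 1, 1 ≤ g(s^b/(1+s^b)) / g(s^a/(1+s^a)) ≤ b/a. -/

import Mathlib

/-- The Gaussian hypergeometric function `₂F₁(a,b;c;x)` defined by its Maclaurin
series `∑ (a)ₙ(b)ₙ/((c)ₙ n!) xⁿ`, where `(a)ₙ` is the rising factorial. -/
noncomputable def hypergeom (a b c x : ℝ) : ℝ :=
  ∑' n : ℕ, ((∏ k ∈ Finset.range n, (a + k)) * (∏ k ∈ Finset.range n, (b + k)) /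
      ((∏ k ∈ Finset.range n, (c + k)) * (Nat.factorial n))) * x ^ n

/-- Monotone rule for ratios of power series with nonnegative coefficients: if `p` is antitone, then
`(∑ pₙ qₙ xⁿ⁺¹) / (∑ qₙ xⁿ⁺¹)` is antitone in `x`. -/
theorem powerSeries_ratio_antitone {p q : ℕ → ℝ} (hp : Antitone p) (hq : ∀ n, 0 ≤ q n)
    {x y A B P Q : ℝ} (hx : 0 < x) (hxy : x < y) (hA : 0 < A)
    (hQx : HasSum (fun n ↦ q n * x ^ (n + 1)) A) (hQy : HasSum (fun n ↦ q n * y ^ (n + 1)) B)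
    (hPx : HasSum (fun n ↦ p n * (q n * x ^ (n + 1))) P)
    (hPy : HasSum (fun n ↦ p n * (q n * y ^ (n + 1))) Q) :
    Q ≤ B / A * P := by
  have hex : ∃ N : ℕ, B / A * x ^ (N + 1) ≤ y ^ (N + 1) := by
    obtain ⟨n, hn⟩ := pow_unbounded_of_one_lt (B / A) ((one_lt_div hx).2 hxy)
    refine ⟨n, ?_⟩
    have h : B / A ≤ (y / x) ^ (n + 1) :=
      hn.le.trans (pow_le_pow_right₀ ((one_lt_div hx).2 hxy).le n.le_succ)
    rwa [div_pow, le_div_iff₀ (by positivity)] at h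
  obtain ⟨N, hN, hmin⟩ : ∃ N : ℕ, B / A * x ^ (N + 1) ≤ y ^ (N + 1) ∧
      ∀ m < N, y ^ (m + 1) < B / A * x ^ (m + 1) := by
    classical
    exact ⟨Nat.find hex, Nat.find_spec hex, fun m hm ↦ not_le.1 (Nat.find_min hex hm)⟩
  have hsum := (hPy.sub (hPx.mul_left (B / A))).sub
    ((hQy.sub (hQx.mul_left (B / A))).mul_left (p N))
  rw [div_mul_cancel₀ B hA.ne', sub_self, mul_zero, sub_zero] at hsum
  refine sub_nonpos.1 (hasSum_le (fun n ↦ ?_) hsum hasSum_zero)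
  have hterm : p n * (q n * y ^ (n + 1)) - B / A * (p n * (q n * x ^ (n + 1))) -
      p N * (q n * y ^ (n + 1) - B / A * (q n * x ^ (n + 1))) =
      q n * ((p n - p N) * (y ^ (n + 1) - B / A * x ^ (n + 1))) := by ring
  rw [hterm]
  refine mul_nonpos_of_nonneg_of_nonpos (hq n) ?_
  rcases lt_or_ge n N with h | h
  · exact mul_nonpos_of_nonneg_of_nonpos (sub_nonneg.2 (hp h.le)) (sub_nonpos.2 (hmin n h).le)
  · refine mul_nonpos_of_nonpos_of_nonneg (sub_nonpos.2 (hp h)) (sub_nonneg.2 ?_)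
    obtain ⟨k, rfl⟩ := Nat.exists_eq_add_of_le h
    calc B / A * x ^ (N + k + 1) = B / A * x ^ (N + 1) * x ^ k := by ring
      _ ≤ y ^ (N + 1) * x ^ k := by gcongr
      _ ≤ y ^ (N + 1) * y ^ k := by
          have : 0 < y := hx.trans hxy
          gcongr
      _ = y ^ (N + k + 1) := by ring

/-- The coefficients of the zero-balanced hypergeometric series `₂F₁(c,d;c+d;x)`. -/
noncomputable def zeroBalancedCoeff (c d : ℝ) (n : ℕ) : ℝ :=
  (∏ k ∈ Finset.range n, (c + k)) * (∏ k ∈ Finset.range n, (d + k)) /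
    ((∏ k ∈ Finset.range n, (c + d + k)) * (Nat.factorial n))

theorem zeroBalancedCoeff_zero (c d : ℝ) : zeroBalancedCoeff c d 0 = 1 := by
  simp [zeroBalancedCoeff]

section

variable {c d : ℝ}

theorem zeroBalancedCoeff_pos (hc : 0 < c) (hd : 0 < d) (n : ℕ) :
    0 < zeroBalancedCoeff c d n := by
  have h : ∀ e : ℝ, 0 < e → 0 < ∏ k ∈ Finset.range n, (e + k) := fun e he ↦
    Finset.prod_pos fun k _ ↦ by positivity
  have h₁ := h c hc
  have h₂ := h d hd
  have h₃ := h (c + d) (by positivity)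
  unfold zeroBalancedCoeff
  positivity

theorem zeroBalancedCoeff_succ (n : ℕ) :
    zeroBalancedCoeff c d (n + 1) =
      zeroBalancedCoeff c d n * ((c + n) * (d + n) / ((c + d + n) * (n + 1))) := by
  simp only [zeroBalancedCoeff, Finset.prod_range_succ, Nat.factorial_succ]
  push_cast
  rw [div_mul_div_comm]
  congr 1 <;> ring

theorem antitone_succ_mul_zeroBalancedCoeff (hc : 0 < c) (hd : 0 < d) (hcd : c * d ≤ 1) :
    Antitone fun n : ℕ ↦ (n + 1 : ℝ) * zeroBalancedCoeff c d n := by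
  refine antitone_nat_of_succ_le fun n ↦ ?_
  have hw := zeroBalancedCoeff_pos hc hd n
  have hsum : 2 * (c * d) ≤ c + d := by
    refine le_of_sq_le_sq ?_ (by positivity)
    nlinarith [sq_nonneg (c - d), mul_pos hc hd]
  have hratio : ((n : ℝ) + 2) * ((c + n) * (d + n) / ((c + d + n) * (n + 1))) ≤ n + 1 := by
    rw [← mul_div_assoc, div_le_iff₀ (by positivity)]
    nlinarith [mul_nonneg (Nat.cast_nonneg (α := ℝ) n) (sub_nonneg.2 hcd)]
  rw [zeroBalancedCoeff_succ]
  push_cast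
  nlinarith [mul_le_mul_of_nonneg_left hratio hw.le]

theorem succ_mul_zeroBalancedCoeff_le_one (hc : 0 < c) (hd : 0 < d) (hcd : c * d ≤ 1) (n : ℕ) :
    (n + 1 : ℝ) * zeroBalancedCoeff c d n ≤ 1 := by
  simpa [zeroBalancedCoeff_zero] using
    antitone_succ_mul_zeroBalancedCoeff hc hd hcd (Nat.zero_le n)

theorem hasSum_mul_hypergeom (hc : 0 < c) (hd : 0 < d) (hcd : c * d ≤ 1) {x : ℝ}
    (hx : 0 ≤ x) (hx1 : x < 1) :
    HasSum (fun n ↦ zeroBalancedCoeff c d n * x ^ (n + 1)) (x * hypergeom c d (c + d) x) := by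
  have hs : Summable fun n ↦ zeroBalancedCoeff c d n * x ^ n := by
    refine Summable.of_nonneg_of_le
      (fun n ↦ mul_nonneg (zeroBalancedCoeff_pos hc hd n).le (pow_nonneg hx n)) (fun n ↦ ?_)
      (summable_geometric_of_lt_one hx hx1)
    refine mul_le_of_le_one_left (pow_nonneg hx n) ?_
    have := succ_mul_zeroBalancedCoeff_le_one hc hd hcd n
    nlinarith [mul_nonneg (Nat.cast_nonneg (α := ℝ) n) (zeroBalancedCoeff_pos hc hd n).le]
  have h : HasSum (fun n ↦ x * (zeroBalancedCoeff c d n * x ^ n)) (x * hypergeom c d (c + d) x) :=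
    hs.hasSum.mul_left x
  convert h using 2 with n
  ring

theorem mul_hypergeom_pos (hc : 0 < c) (hd : 0 < d) (hcd : c * d ≤ 1) {x : ℝ}
    (hx : 0 < x) (hx1 : x < 1) : 0 < x * hypergeom c d (c + d) x := by
  have h := le_hasSum (hasSum_mul_hypergeom hc hd hcd hx.le hx1) 0 fun n _ ↦
    mul_nonneg (zeroBalancedCoeff_pos hc hd n).le (pow_nonneg hx.le _)
  simp only [zeroBalancedCoeff_zero, zero_add, pow_one, one_mul] at h
  exact hx.trans_le h

theorem mul_hypergeom_mono (hc : 0 < c) (hd : 0 < d) (hcd : c * d ≤ 1) {x y : ℝ}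
    (hx : 0 ≤ x) (hxy : x ≤ y) (hy : y < 1) :
    x * hypergeom c d (c + d) x ≤ y * hypergeom c d (c + d) y :=
  hasSum_le (fun n ↦ mul_le_mul_of_nonneg_left (pow_le_pow_left₀ hx hxy _)
    (zeroBalancedCoeff_pos hc hd n).le) (hasSum_mul_hypergeom hc hd hcd hx (hxy.trans_lt hy))
    (hasSum_mul_hypergeom hc hd hcd (hx.trans hxy) hy)

/-- `x F(c,d;c+d;x) / (-log (1 - x))` is antitone on `(0, 1)` when `c d ≤ 1`. -/
theorem mul_hypergeom_le_log_ratio_mul (hc : 0 < c) (hd : 0 < d) (hcd : c * d ≤ 1) {x y : ℝ}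
    (hx : 0 < x) (hxy : x ≤ y) (hy : y < 1) :
    y * hypergeom c d (c + d) y ≤
      -Real.log (1 - y) / -Real.log (1 - x) * (x * hypergeom c d (c + d) x) := by
  have hlog : 0 < -Real.log (1 - x) :=
    neg_pos.2 (Real.log_neg (by linarith) (by linarith))
  rcases hxy.eq_or_lt with rfl | hlt
  · rw [div_self hlog.ne', one_mul]
  have hQ : ∀ z : ℝ, 0 < z → z < 1 →
      HasSum (fun n : ℕ ↦ (1 / (n + 1 : ℝ)) * z ^ (n + 1)) (-Real.log (1 - z)) := by
    intro z hz hz1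
    convert Real.hasSum_pow_div_log_of_abs_lt_one (abs_lt.2 ⟨by linarith, hz1⟩) using 2 with n
    ring
  have hP : ∀ z : ℝ, 0 < z → z < 1 →
      HasSum (fun n : ℕ ↦ ((n + 1 : ℝ) * zeroBalancedCoeff c d n) *
        ((1 / (n + 1 : ℝ)) * z ^ (n + 1))) (z * hypergeom c d (c + d) z) := by
    intro z hz hz1
    convert hasSum_mul_hypergeom hc hd hcd hz.le hz1 using 2 with n
    field_simp
  exact powerSeries_ratio_antitone (antitone_succ_mul_zeroBalancedCoeff hc hd hcd)
    (fun n ↦ by positivity) hx hlt hlog (hQ x hx (hxy.trans_lt hy)) (hQ y (hx.trans hlt) hy)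
    (hP x hx (hxy.trans_lt hy)) (hP y (hx.trans hlt) hy)

end

theorem log_one_add_rpow_div_le {s a b : ℝ} (hs : 0 < s) (ha : 0 < a) (hab : a ≤ b) :
    Real.log (1 + s ^ b) / Real.log (1 + s ^ a) ≤ b / a := by
  have hsa : 0 < s ^ a := Real.rpow_pos_of_pos hs a
  have hsb : 0 < s ^ b := Real.rpow_pos_of_pos hs b
  rw [div_le_iff₀ (Real.log_pos (by linarith)), ← Real.log_rpow (by positivity)]
  refine Real.log_le_log (by positivity) ?_
  have h := Real.add_rpow_le_rpow_add zero_le_one hsa.le ((one_le_div ha).2 hab)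
  rwa [Real.one_rpow, ← Real.rpow_mul hs.le, mul_div_cancel₀ b ha.ne'] at h

/-- Corollary 4.8: for `b ≥ a > 0`, `c, d > 0` with `cd ≤ 1` and
`g(x) = x·F(c,d;c+d;x)`, the inequality
`1 ≤ g(s^b/(1+s^b)) / g(s^a/(1+s^a)) ≤ b/a` holds for every `s ≥ 1`. -/
theorem hypergeom_power_ratio_bounds (c d a b : ℝ) (hc : 0 < c) (hd : 0 < d)
    (hcd : c * d ≤ 1) (ha : 0 < a) (hab : a ≤ b) (s : ℝ) (hs : 1 ≤ s) :
    1 ≤ (s ^ b / (1 + s ^ b) * hypergeom c d (c + d) (s ^ b / (1 + s ^ b))) /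
        (s ^ a / (1 + s ^ a) * hypergeom c d (c + d) (s ^ a / (1 + s ^ a))) ∧
    (s ^ b / (1 + s ^ b) * hypergeom c d (c + d) (s ^ b / (1 + s ^ b))) /
        (s ^ a / (1 + s ^ a) * hypergeom c d (c + d) (s ^ a / (1 + s ^ a))) ≤ b / a := by
  have hs0 : 0 < s := zero_lt_one.trans_le hs
  have hsa : 0 < s ^ a := Real.rpow_pos_of_pos hs0 a
  have hsb : 0 < s ^ b := Real.rpow_pos_of_pos hs0 b
  have hle : s ^ a ≤ s ^ b := Real.rpow_le_rpow_of_exponent_le hs hab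
  have hx : 0 < s ^ a / (1 + s ^ a) := by positivity
  have hy : s ^ b / (1 + s ^ b) < 1 := (div_lt_one (by positivity)).2 (by linarith)
  have hxy : s ^ a / (1 + s ^ a) ≤ s ^ b / (1 + s ^ b) := by
    rw [div_le_div_iff₀ (by positivity) (by positivity)]
    linarith
  have hpos := mul_hypergeom_pos hc hd hcd hx (hxy.trans_lt hy)
  have hlog : ∀ t : ℝ, 0 < t → -Real.log (1 - t / (1 + t)) = Real.log (1 + t) := by
    intro t ht
    rw [← Real.log_inv]
    congr 1
    field_simp
    ring
  refine ⟨(one_le_div hpos).2 (mul_hypergeom_mono hc hd hcd hx.le hxy hy),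
    (div_le_iff₀ hpos).2 ?_⟩
  have h := mul_hypergeom_le_log_ratio_mul hc hd hcd hx hxy hy
  rw [hlog _ hsa, hlog _ hsb] at h
  exact h.trans (mul_le_mul_of_nonneg_right (log_one_add_rpow_div_le hs0 ha hab) hpos.le)
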